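/- Let T be a finite tree with vertex set V of cardinality n, and let I be a nonempty proper subset of V. Then min_{X ∈ V} D(I, T^X) = n − max_{1 ≤ j ≤ J(I)} |C_j(I)|, where C_1(I),…,C_{J(I)}(I) are the vertex sets of the connected components of the subgraph of T induced on V∖I. -/

import Mathlib

/-- In the `X`-rooted orientation of the tree `T`, the edge `{u,v}` is directed as `u → v`
exactly when `u` and `v` are adjacent and `u` lies on the (unique) path in `T` from `X` to
`v` (all edges point away from the root `X`). -/
def rootedDir {V : Type*} (T : SimpleGraph V) (X u v : V) : Prop :=
  T.Adj u v ∧ ∀ p : T.Path X v, u ∈ p.val.support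

/-- The `X`-rooted and `Y`-rooted orientations of `T` assign the same direction to the
edge `e`. -/
def agreesOn {V : Type*} (T : SimpleGraph V) (X Y : V) (e : Sym2 V) : Prop :=
  ∀ u v : V, e = s(u, v) → (rootedDir T X u v ↔ rootedDir T Y u v)

/-- An edge `e` of `T` is *identified* by the target set `I` with respect to the root `X` if
every vertex `Y` whose rooted orientation `T^Y` assigns the same direction as `T^X` to every
edge incident to a vertex of `I` also assigns the same direction as `T^X` to `e`. -/
def identified {V : Type*} (T : SimpleGraph V) (X : V) (I : Set V) (e : Sym2 V) : Prop :=
  e ∈ T.edgeSet ∧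
    ∀ Y : V, (∀ e' ∈ T.edgeSet, (∃ x ∈ I, x ∈ e') → agreesOn T X Y e') → agreesOn T X Y e

/-- The gain `D(I, T^X)`: the number of edges of `T` identified by `I` with respect to the
root `X`. -/
noncomputable def gain {V : Type*} (T : SimpleGraph V) (X : V) (I : Set V) : ℕ :=
  {e | identified T X I e}.ncard

/-- `Desc_X(w)`: the set of vertices `v` such that `w` lies on the unique path from `X`
to `v`. -/
def desc {V : Type*} (T : SimpleGraph V) (X w : V) : Set V :=
  {v | ∀ p : T.Path X v, w ∈ p.val.support}

/-- The vertex set of the connected component containing `y` of the subgraph of `T` induced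
on the complement of `I`. -/
def comp {V : Type*} (T : SimpleGraph V) (I : Set V) (y : V) : Set V :=
  {z | ∃ p : T.Walk y z, ∀ u ∈ p.support, u ∉ I}

namespace SimpleGraph

variable {V : Type*} {T : SimpleGraph V}

/-- The graph `T` with all edges incident to a vertex of `I` deleted. -/
def cutAt (T : SimpleGraph V) (I : Set V) : SimpleGraph V :=
  T.deleteEdges {e | ∃ x ∈ I, x ∈ e}

lemma cutAt_adj {I : Set V} {u v : V} : (T.cutAt I).Adj u v ↔ T.Adj u v ∧ u ∉ I ∧ v ∉ I := by
  simp only [cutAt, deleteEdges_adj, Set.mem_ofPred_eq, Sym2.mem_iff]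
  grind

lemma cutAt_le (I : Set V) : T.cutAt I ≤ T := deleteEdges_le _

lemma IsAcyclic.not_reachable_deleteEdges (hT : T.IsAcyclic) {u v : V} (h : T.Adj u v) :
    ¬ (T.deleteEdges {s(u, v)}).Reachable u v := by
  have := isAcyclic_iff_forall_isBridge.1 hT (T.mem_edgeSet.2 h)
  rw [isBridge_iff] at this
  exact this

lemma IsAcyclic.reachable_deleteEdges_iff (hT : T.IsAcyclic) {X Y : V} (p : T.Path X Y)
    (e : Sym2 V) : (T.deleteEdges {e}).Reachable X Y ↔ e ∉ p.val.edges := by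
  classical
  constructor
  · rintro ⟨w⟩ he
    have hw : e ∉ (w.mapLe (deleteEdges_le {e})).edges := by
      intro h
      rw [Walk.edges_mapLe_eq_edges] at h
      have := w.edges_subset_edgeSet h
      simp [edgeSet_deleteEdges] at this
    have hp : p = (w.mapLe (deleteEdges_le {e})).toPath := (hT.subsingleton_path _ _).elim _ _
    rw [hp] at he
    exact hw (Walk.edges_bypass_subset_edges _ he)
  · intro he
    exact ⟨p.val.toDeleteEdge e he⟩

lemma IsTree.rootedDir_iff (hT : T.IsTree) {X u v : V} :
    rootedDir T X u v ↔ T.Adj u v ∧ ¬ (T.deleteEdges {s(u, v)}).Reachable X v := by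
  classical
  refine and_congr_right fun huv => ?_
  obtain ⟨w⟩ := hT.connected.preconnected X v
  rw [hT.isAcyclic.reachable_deleteEdges_iff w.toPath, not_not]
  constructor
  · intro h
    have hu := h w.toPath
    have hq : (⟨_, w.toPath.property.dropUntil hu⟩ : T.Path u v) = Path.singleton huv :=
      (hT.isAcyclic.subsingleton_path _ _).elim _ _
    apply Walk.edges_dropUntil_subset_edges w.toPath.val hu
    rw [show w.toPath.val.dropUntil u hu = _ from congrArg Subtype.val hq]
    simp [Path.singleton]
  · intro h p
    rw [(hT.isAcyclic.subsingleton_path _ _).elim p w.toPath]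
    exact Walk.fst_mem_support_of_mem_edges _ h

lemma IsTree.agreesOn_iff (hT : T.IsTree) {X Y : V} {e : Sym2 V} (he : e ∈ T.edgeSet) :
    agreesOn T X Y e ↔ (T.deleteEdges {e}).Reachable X Y := by
  constructor
  · induction e with | h u v =>
    intro h
    have key : ∀ Z, (T.deleteEdges {s(u, v)}).Reachable Z v ∨
        (T.deleteEdges {s(u, v)}).Reachable Z u := by
      intro Z
      by_contra! hZ
      have h1 := (hT.rootedDir_iff (X := Z)).2 ⟨T.mem_edgeSet.1 he, hZ.1⟩
      have h2 : rootedDir T Z v u :=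
        hT.rootedDir_iff.2 ⟨(T.mem_edgeSet.1 he).symm, by rw [Sym2.eq_swap]; exact hZ.2⟩
      classical
      obtain ⟨w⟩ := hT.connected.preconnected Z u
      have hv := h2.2 w.toPath
      have hu := h1.2 ⟨_, w.toPath.property.takeUntil hv⟩
      exact Walk.endpoint_notMem_support_takeUntil w.toPath.property hv
        (T.mem_edgeSet.1 he).ne hu
    have huv := h u v rfl
    rw [hT.rootedDir_iff, hT.rootedDir_iff] at huv
    have hadj := T.mem_edgeSet.1 he
    by_cases hX : (T.deleteEdges {s(u, v)}).Reachable X v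
    · have hY : (T.deleteEdges {s(u, v)}).Reachable Y v := by tauto
      exact hX.trans hY.symm
    · have hY : ¬ (T.deleteEdges {s(u, v)}).Reachable Y v := by tauto
      exact ((key X).resolve_left hX).trans ((key Y).resolve_left hY).symm
  · rintro h u v rfl
    rw [hT.rootedDir_iff, hT.rootedDir_iff]
    exact and_congr_right fun _ => not_congr ⟨h.symm.trans, h.trans⟩

lemma IsTree.forall_agreesOn_iff (hT : T.IsTree) {X Y : V} {I : Set V} :
    (∀ e ∈ T.edgeSet, (∃ x ∈ I, x ∈ e) → agreesOn T X Y e) ↔ (T.cutAt I).Reachable X Y := by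
  classical
  constructor
  · intro h
    obtain ⟨w⟩ := hT.connected.preconnected X Y
    refine ⟨w.toPath.val.toDeleteEdges _ fun e he hI => ?_⟩
    have heT := w.toPath.val.edges_subset_edgeSet he
    exact (hT.isAcyclic.reachable_deleteEdges_iff w.toPath e).1
      ((hT.agreesOn_iff heT).1 (h e heT hI)) he
  · intro h e he hI
    rw [hT.agreesOn_iff he]
    exact h.mono (deleteEdges_anti (Set.singleton_subset_iff.2 hI))

lemma IsTree.not_identified_edges (hT : T.IsTree) (X : V) (I : Set V) :
    T.edgeSet \ {e | identified T X I e} =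
      Sym2.map Subtype.val '' ((T.cutAt I).connectedComponentMk X).toSimpleGraph.edgeSet := by
  ext e
  simp only [Set.mem_sdiff, Set.mem_ofPred_eq, identified, hT.forall_agreesOn_iff, Set.mem_image]
  constructor
  · rintro ⟨he, hn⟩
    push Not at hn
    obtain ⟨Y, ⟨w⟩, hY⟩ := hn he
    rw [hT.agreesOn_iff he] at hY
    have hew : e ∈ w.edges := by
      by_contra hew
      exact hY ((w.toDeleteEdge e hew).reachable.mono (deleteEdges_mono (cutAt_le I)))
    have heH := w.edges_subset_edgeSet hew
    induction e with | h u v =>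
    have hu : (T.cutAt I).Reachable X u := by
      classical
      exact ⟨w.takeUntil u (Walk.fst_mem_support_of_mem_edges _ hew)⟩
    have hv : (T.cutAt I).Reachable X v := hu.trans (Adj.reachable heH)
    refine ⟨s(⟨u, ConnectedComponent.sound hu.symm⟩, ⟨v, ConnectedComponent.sound hv.symm⟩),
      heH, rfl⟩
  · rintro ⟨e, he, rfl⟩
    induction e with | h u v =>
    have hH : (T.cutAt I).Adj u v := he
    have hadj : T.Adj u v := cutAt_le I hH
    refine ⟨hadj, fun h => ?_⟩
    have hr : ∀ z : ((T.cutAt I).connectedComponentMk X),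
        (T.deleteEdges {s(u.val, v.val)}).Reachable X z := fun z =>
      (hT.agreesOn_iff (T.mem_edgeSet.2 hadj)).1
        (h.2 z (ConnectedComponent.exact z.property).symm)
    exact hT.isAcyclic.not_reachable_deleteEdges hadj ((hr u).symm.trans (hr v))

lemma IsTree.gain_add_ncard_supp [Fintype V] (hT : T.IsTree) (X : V) (I : Set V) :
    gain T X I + ((T.cutAt I).connectedComponentMk X).supp.ncard = Fintype.card V := by
  classical
  set C := (T.cutAt I).connectedComponentMk X with hC
  have hCT : C.toSimpleGraph.IsTree :=
    ⟨C.connected_toSimpleGraph, (hT.isAcyclic.anti (cutAt_le I)).induce _⟩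
  have h1 := hT.card_edgeFinset
  have h2 := hCT.card_edgeFinset
  have h3 := Set.ncard_sdiff_add_ncard_of_subset
    (show {e | identified T X I e} ⊆ T.edgeSet from fun e he => he.1)
  rw [hT.not_identified_edges, Set.ncard_image_of_injective _
    (Sym2.map.injective Subtype.val_injective), ← hC] at h3
  rw [edgeFinset, ← Set.ncard_eq_toFinset_card'] at h1 h2
  have h4 : C.supp.ncard = Fintype.card C := by
    rw [← Nat.card_coe_set_eq, ← Nat.card_eq_fintype_card]; rfl
  have h5 : gain T X I = {e | identified T X I e}.ncard := rfl
  omega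

lemma comp_eq_supp_cutAt {I : Set V} {y : V} (hy : y ∉ I) :
    comp T I y = ((T.cutAt I).connectedComponentMk y).supp := by
  ext z
  rw [ConnectedComponent.mem_supp_iff, ConnectedComponent.eq, reachable_comm]
  constructor
  · rintro ⟨p, hp⟩
    refine ⟨p.toDeleteEdges _ ?_⟩
    rintro e he ⟨x, hx, hxe⟩
    exact hp x (Walk.mem_support_of_mem_edges he hxe) hx
  · rintro ⟨p⟩
    refine ⟨p.mapLe (cutAt_le I), ?_⟩
    rw [Walk.support_mapLe_eq_support]
    induction p with
    | nil => simpa using hy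
    | cons h p ih =>
      have := cutAt_adj.1 h
      simp only [Walk.support_cons, List.mem_cons]
      rintro u (rfl | hu)
      exacts [hy, ih this.2.2 u hu]

lemma supp_cutAt_of_mem {I : Set V} {x : V} (hx : x ∈ I) :
    ((T.cutAt I).connectedComponentMk x).supp = {x} := by
  ext z
  rw [ConnectedComponent.mem_supp_iff, ConnectedComponent.eq, reachable_comm,
    Set.mem_singleton_iff]
  constructor
  · rintro ⟨p⟩
    cases p with
    | nil => rfl
    | cons h p => exact absurd hx (cutAt_adj.1 h).2.1
  · rintro rfl
    rfl

end SimpleGraph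

/-- **Worst-case gain reduction (equation (13))**: For a finite tree `T` of order `n` and a
nonempty proper target set `I`, the worst-case gain `min_{X ∈ V} D(I, T^X)` equals `n` minus
the maximum cardinality of a connected component of the subgraph of `T` induced on the
complement of `I`. -/
theorem min_gain_eq_card_sub_max_component
    {V : Type*} [Fintype V] (T : SimpleGraph V) (hT : T.IsTree) (I : Set V)
    (hne : I.Nonempty) (hproper : I ≠ Set.univ) :
    sInf (Set.range fun X : V => gain T X I) =
      Fintype.card V -
        sSup ((fun C : Set V => C.ncard) ''
          {C : Set V | ∃ y : V, y ∉ I ∧ C = comp T I y}) := by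
  set f : V → ℕ := fun y => ((T.cutAt I).connectedComponentMk y).supp.ncard with hf
  have hgain : ∀ X, gain T X I + f X = Fintype.card V := fun X => hT.gain_add_ncard_supp X I
  obtain ⟨y₀, hy₀, hmax⟩ := Set.exists_max_image Iᶜ f (Set.toFinite _)
    (Set.nonempty_compl.2 hproper)
  have hpos : 1 ≤ f y₀ := (Set.ncard_pos (Set.toFinite _)).2 ⟨y₀, rfl⟩
  have hall : ∀ X, f X ≤ f y₀ := by
    intro X
    by_cases hX : X ∈ I
    · simpa [hf, SimpleGraph.supp_cutAt_of_mem hX] using hpos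
    · exact hmax X hX
  have hsup : IsGreatest ((fun C : Set V => C.ncard) ''
      {C : Set V | ∃ y : V, y ∉ I ∧ C = comp T I y}) (f y₀) := by
    constructor
    · exact ⟨_, ⟨y₀, hy₀, rfl⟩, by simp only [SimpleGraph.comp_eq_supp_cutAt hy₀, hf]⟩
    · rintro _ ⟨_, ⟨y, hy, rfl⟩, rfl⟩
      simpa only [SimpleGraph.comp_eq_supp_cutAt hy] using hmax y hy
  have hinf : IsLeast (Set.range fun X : V => gain T X I) (Fintype.card V - f y₀) := by
    constructor
    · exact ⟨y₀, by have := hgain y₀; dsimp only; omega⟩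
    · rintro _ ⟨X, rfl⟩
      have := hgain X
      have := hall X
      dsimp only
      omega
  rw [hsup.csSup_eq, hinf.csInf_eq]
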